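/- arXiv:2211.14707 — 2 statements merged into one kernel-verified Lean document; each statement's English description precedes it below -/
import Mathlib

section
/- If P is a moderately meet continuous quasiexact poset, then every Scott open subset of P is open in the wwb topology, and the wwb topology coincides with the wf topology; that is, σ(P) ⊆ τ_wwb(P) = τ_wf(P). -/
open Set TopologicalSpace

variable {α : Type*}

/-- The upper closure `↑A = {p : ∃ a ∈ A, a ≤ p}`. -/
def upSet [PartialOrder α] (A : Set α) : Set α := {p | ∃ a ∈ A, a ≤ p}

/-- The lower closure `↓A = {p : ∃ a ∈ A, p ≤ a}`. -/
def downSet [PartialOrder α] (A : Set α) : Set α := {p | ∃ a ∈ A, p ≤ a}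

/-- A nonempty subset `D` is directed if every two elements have an upper bound in `D`. -/
def IsDirectedSet [PartialOrder α] (D : Set α) : Prop :=
  D.Nonempty ∧ ∀ a ∈ D, ∀ b ∈ D, ∃ c ∈ D, a ≤ c ∧ b ≤ c

/-- `G` is weakly way below `H` (`G ≪_w H`): for every directed `D` whose sup exists,
`sup D ∈ H` implies `d ∈ ↑G` for some `d ∈ D`. -/
def WWB [PartialOrder α] (G H : Set α) : Prop :=
  ∀ D : Set α, IsDirectedSet D → ∀ s : α, IsLUB D s → s ∈ H → ∃ d ∈ D, d ∈ upSet G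

/-- `↟_w G = {a : G ≪_w a}`. -/
def wUp [PartialOrder α] (G : Set α) : Set α := {a | WWB G {a}}

/-- `fin_w(x)`: all finite nonempty subsets `F` with `F ≪_w x`. -/
def finW [PartialOrder α] (x : α) : Set (Set α) :=
  {F | F.Finite ∧ F.Nonempty ∧ WWB F {x}}

/-- `fin_(bl)w(x) = {F ∈ fin_w(x) : F ⊆ ↓x}`. -/
def finBlW [PartialOrder α] (x : α) : Set (Set α) :=
  {F | F ∈ finW x ∧ F ⊆ downSet {x}}

/-- A family `𝓕` of subsets is directed if for `F₁, F₂ ∈ 𝓕` there is `F₃ ∈ 𝓕`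
with `F₃ ⊆ ↑F₁ ∩ ↑F₂`. -/
def DirectedFam [PartialOrder α] (𝓕 : Set (Set α)) : Prop :=
  ∀ F₁ ∈ 𝓕, ∀ F₂ ∈ 𝓕, ∃ F₃ ∈ 𝓕, F₃ ⊆ upSet F₁ ∩ upSet F₂

/-- `P` is quasiexact if for each `x` the family `fin_w(x)` is directed and
`⋂ {↑F : F ∈ fin_w(x)} = ↑x`. -/
def Quasiexact (α : Type*) [PartialOrder α] : Prop :=
  ∀ x : α, DirectedFam (finW x) ∧ (⋂ F ∈ finW x, upSet F) = upSet {x}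

/-- A dcpo: every directed subset has a supremum. -/
def IsDcpo (α : Type*) [PartialOrder α] : Prop :=
  ∀ D : Set α, IsDirectedSet D → ∃ s : α, IsLUB D s

/-- The wf topology: generated by the subbasis `{↟_w F : F finite nonempty}`. -/
def wfTopology (α : Type*) [PartialOrder α] : TopologicalSpace α :=
  generateFrom {U | ∃ F : Set α, F.Finite ∧ F.Nonempty ∧ U = wUp F}

/-- The wwb topology: generated by the subbasis `{↟_w x : x ∈ P}`. -/
def wwbTopology (α : Type*) [PartialOrder α] : TopologicalSpace α :=
  generateFrom {U | ∃ x : α, U = wUp {x}}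

/-- `P` is moderately meet continuous: `x ≤ sup D` implies
`x ∈ cl_{τ_wf}(↓D ∩ ↓x)` for every directed `D` whose sup exists. -/
def ModMeetCont (α : Type*) [PartialOrder α] : Prop :=
  ∀ x : α, ∀ D : Set α, IsDirectedSet D → ∀ s : α, IsLUB D s → x ≤ s →
    x ∈ @closure α (wfTopology α) (downSet D ∩ downSet {x})

/-- `U` is Scott open: `U = ↑U` and every directed set whose sup lies in `U` meets `U`. -/
def IsScottOpen [PartialOrder α] (U : Set α) : Prop :=
  upSet U = U ∧
    ∀ D : Set α, IsDirectedSet D → ∀ s : α, IsLUB D s → s ∈ U → (D ∩ U).Nonempty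

/-- The Scott topology. -/
def scottTopology (α : Type*) [PartialOrder α] : TopologicalSpace α :=
  generateFrom {U | IsScottOpen U}

/-- `P` is exact: for every `x` the set `{y : y ≪_w x}` is directed with supremum `x`. -/
def ExactPoset (α : Type*) [PartialOrder α] : Prop :=
  ∀ x : α, IsDirectedSet {y | WWB {y} {x}} ∧ IsLUB {y | WWB {y} {x}} x

/-- `x` is way below `y`: for every directed `D` whose sup exists,
`y ≤ sup D` implies `x ≤ d` for some `d ∈ D`. -/
def WayBelowPt [PartialOrder α] (x y : α) : Prop :=
  ∀ D : Set α, IsDirectedSet D → ∀ s : α, IsLUB D s → y ≤ s → ∃ d ∈ D, x ≤ d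

/-- `G` is way below `H`: for every directed `D` whose sup exists,
`sup D ∈ ↑H` implies `d ∈ ↑G` for some `d ∈ D`. -/
def WayBelowSet [PartialOrder α] (G H : Set α) : Prop :=
  ∀ D : Set α, IsDirectedSet D → ∀ s : α, IsLUB D s → s ∈ upSet H → ∃ d ∈ D, d ∈ upSet G

/-- `fin(x)`: all finite nonempty subsets `F` with `F ≪ x`. -/
def finWB [PartialOrder α] (x : α) : Set (Set α) :=
  {F | F.Finite ∧ F.Nonempty ∧ WayBelowSet F {x}}

/-- The relation `≪_w` is weakly increasing: `x ≪_w y ≤ z ≪_w u` implies `x ≪_w z`. -/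
def WeaklyIncreasing (α : Type*) [PartialOrder α] : Prop :=
  ∀ x y z u : α, WWB {x} {y} → y ≤ z → WWB {z} {u} → WWB {x} {z}

open scoped Topology

theorem isDirectedSet_singleton [PartialOrder α] (a : α) : IsDirectedSet ({a} : Set α) := by
  refine ⟨singleton_nonempty a, ?_⟩
  rintro _ rfl _ rfl
  exact ⟨_, rfl, le_rfl, le_rfl⟩

theorem WWB.mem_upSet [PartialOrder α] {F : Set α} {a : α} (h : WWB F {a}) : a ∈ upSet F := by
  obtain ⟨_, rfl, hd⟩ := h {a} (isDirectedSet_singleton a) a isLUB_singleton rfl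
  exact hd

theorem WWB.le [PartialOrder α] {y a : α} (h : WWB {y} {a}) : y ≤ a := by
  obtain ⟨_, rfl, hd⟩ := h.mem_upSet
  exact hd

theorem WWB.mono_left [PartialOrder α] {F G H : Set α} (h : WWB G H) (hGF : G ⊆ F) :
    WWB F H := by
  intro D hD s hs hsH
  obtain ⟨d, hd, g, hg, hgd⟩ := h D hD s hs hsH
  exact ⟨d, hd, g, hGF hg, hgd⟩

/-- In a moderately meet continuous poset, a wf-open neighbourhood of `a` contains an element
lying below all members of a finite family of directed sets with supremum `a`. -/
theorem ModMeetCont.exists_mem_forall_mem_downSet [PartialOrder α] (hmmc : ModMeetCont α)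
    {a : α} {V : Set α} (hV : IsOpen[wfTopology α] V) (haV : a ∈ V) (E : α → Set α)
    {F : Set α} (hF : F.Finite) (hE : ∀ y ∈ F, IsDirectedSet (E y) ∧ IsLUB (E y) a) :
    ∃ u ∈ V, u ≤ a ∧ ∀ y ∈ F, u ∈ downSet (E y) := by
  let _ := wfTopology α
  induction F, hF using Set.Finite.induction_on with
  | empty => exact ⟨a, haV, le_rfl, by simp⟩
  | @insert y F _ _ ih =>
    obtain ⟨u, huV, hua, hu⟩ := ih fun z hz => hE z (mem_insert_of_mem y hz)
    obtain ⟨hdir, hlub⟩ := hE y (mem_insert y F)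
    obtain ⟨v, hvV, hvE, w, rfl, hvw⟩ :=
      mem_closure_iff.1 (hmmc u (E y) hdir a hlub hua) V hV huV
    refine ⟨v, hvV, hvw.trans hua, ?_⟩
    rintro z (rfl | hz)
    · exact hvE
    · obtain ⟨e, he, hwe⟩ := hu z hz
      exact ⟨e, he, hvw.trans hwe⟩

/-- In a moderately meet continuous poset, a finite set weakly way below `a` has an element
weakly way below `a`. -/
theorem ModMeetCont.exists_mem_wwb [PartialOrder α] (hmmc : ModMeetCont α) {F : Set α} {a : α}
    (hF : F ∈ finW a) : ∃ y ∈ F, WWB {y} {a} := by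
  obtain ⟨hfin, hne, hw⟩ := hF
  by_contra! hcon
  have key : ∀ y, ∃ D : Set α, y ∈ F → IsDirectedSet D ∧ IsLUB D a ∧ y ∉ downSet D := by
    intro y
    by_cases hy : y ∈ F
    · by_contra! hD
      refine hcon y hy fun D hdir s hs hsa => ?_
      obtain rfl : s = a := hsa
      obtain ⟨d, hd, hyd⟩ := (hD D).2 hdir hs
      exact ⟨d, hd, y, rfl, hyd⟩
    · exact ⟨∅, fun h => absurd h hy⟩
  choose E hE using key
  have hopen : IsOpen[wfTopology α] (wUp F) :=
    isOpen_generateFrom_of_mem ⟨F, hfin, hne, rfl⟩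
  obtain ⟨u, huF, -, hu⟩ := hmmc.exists_mem_forall_mem_downSet hopen hw E hfin
    fun y hy => ⟨(hE y hy).1, (hE y hy).2.1⟩
  obtain ⟨y, hy, hyu⟩ := WWB.mem_upSet huF
  obtain ⟨e, he, hue⟩ := hu y hy
  exact (hE y hy).2.2 ⟨e, he, hyu.trans hue⟩

theorem Quasiexact.finW_nonempty [PartialOrder α] (hqe : Quasiexact α) (x : α) :
    (finW x).Nonempty := by
  by_contra hempty
  have hbot : ∀ z, x ≤ z := by
    intro z
    have hz : z ∈ ⋂ F ∈ finW x, upSet F := by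
      simp [not_nonempty_iff_eq_empty.1 hempty]
    rw [(hqe x).2] at hz
    obtain ⟨_, rfl, h⟩ := hz
    exact h
  refine hempty ⟨{x}, finite_singleton x, singleton_nonempty x, fun D hD s _ _ => ?_⟩
  obtain ⟨d, hd⟩ := hD.1
  exact ⟨d, hd, x, rfl, hbot d⟩

theorem ModMeetCont.exactPoset [PartialOrder α] (hmmc : ModMeetCont α) (hqe : Quasiexact α) :
    ExactPoset α := by
  intro x
  refine ⟨⟨?_, ?_⟩, fun y hy => WWB.le hy, fun u hu => ?_⟩
  · obtain ⟨F, hF⟩ := hqe.finW_nonempty x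
    obtain ⟨y, -, hy⟩ := hmmc.exists_mem_wwb hF
    exact ⟨y, hy⟩
  · intro a ha b hb
    obtain ⟨F, hF, hsub⟩ := (hqe x).1 {a} ⟨finite_singleton a, singleton_nonempty a, ha⟩
      {b} ⟨finite_singleton b, singleton_nonempty b, hb⟩
    obtain ⟨y, hyF, hy⟩ := hmmc.exists_mem_wwb hF
    obtain ⟨⟨_, rfl, hay⟩, ⟨_, rfl, hby⟩⟩ := hsub hyF
    exact ⟨y, hy, hay, hby⟩
  · have hmem : u ∈ ⋂ F ∈ finW x, upSet F := by
      refine mem_iInter₂.2 fun F hF => ?_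
      obtain ⟨y, hyF, hy⟩ := hmmc.exists_mem_wwb hF
      exact ⟨y, hyF, hu hy⟩
    rw [(hqe x).2] at hmem
    obtain ⟨_, rfl, h⟩ := hmem
    exact h

theorem ExactPoset.isOpen_wwbTopology [PartialOrder α] (hex : ExactPoset α) {U : Set α}
    (hU : IsScottOpen U) : IsOpen[wwbTopology α] U := by
  let _ := wwbTopology α
  refine isOpen_iff_forall_mem_open.2 fun x hx => ?_
  obtain ⟨y, hy, hyU⟩ := hU.2 _ (hex x).1 x (hex x).2 hx
  refine ⟨wUp {y}, fun z hz => ?_, isOpen_generateFrom_of_mem ⟨y, rfl⟩, hy⟩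
  rw [← hU.1]
  exact ⟨y, hyU, WWB.le hz⟩

theorem ModMeetCont.wwbTopology_eq_wfTopology [PartialOrder α] (hmmc : ModMeetCont α) :
    wwbTopology α = wfTopology α := by
  apply le_antisymm
  · refine le_generateFrom ?_
    rintro _ ⟨F, hfin, hne, rfl⟩
    let _ := wwbTopology α
    refine isOpen_iff_forall_mem_open.2 fun a ha => ?_
    obtain ⟨y, hyF, hy⟩ := hmmc.exists_mem_wwb ⟨hfin, hne, ha⟩
    exact ⟨wUp {y}, fun z hz => WWB.mono_left hz (singleton_subset_iff.2 hyF),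
      isOpen_generateFrom_of_mem ⟨y, rfl⟩, hy⟩
  · refine le_generateFrom ?_
    rintro _ ⟨x, rfl⟩
    exact isOpen_generateFrom_of_mem ⟨{x}, finite_singleton x, singleton_nonempty x, rfl⟩

/-- For a moderately meet continuous quasiexact poset,
`σ(P) ⊆ τ_wwb(P) = τ_wf(P)`. -/
theorem scott_subset_wwb_eq_wf [PartialOrder α] (hqe : Quasiexact α)
    (hmmc : ModMeetCont α) :
    (∀ U : Set α, IsScottOpen U → (wwbTopology α).IsOpen U) ∧
      wwbTopology α = wfTopology α :=
  ⟨fun _ hU => (hmmc.exactPoset hqe).isOpen_wwbTopology hU, hmmc.wwbTopology_eq_wfTopology⟩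
end

section
/- A dcpo P is quasiexact if and only if for every x ∈ P there exists a directed subfamily 𝓕 ⊆ fin_w(x) such that ⋂{↑F : F ∈ 𝓕} = ↑x. -/
open Set TopologicalSpace

variable {α : Type*}

/-- A finite set meeting every member of a nonempty chain meets its intersection. -/
theorem inter_sInter_nonempty_of_isChain {c : Set (Set α)} (hc : IsChain (· ⊆ ·) c)
    (hne : c.Nonempty) {F : Set α} (hF : F.Finite) (h : ∀ E ∈ c, (F ∩ E).Nonempty) :
    (F ∩ ⋂₀ c).Nonempty := by
  by_contra hcon
  have avoid : ∀ f ∈ F, ∃ E ∈ c, f ∉ E := by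
    intro f hf
    by_contra! hall
    exact hcon ⟨f, hf, hall⟩
  have avoid_all : ∃ E ∈ c, ∀ f ∈ F, f ∉ E := by
    clear h hcon
    induction F, hF using Set.Finite.induction_on with
    | empty => exact hne.imp fun E hE => ⟨hE, by simp⟩
    | @insert a s _ _ ih =>
      obtain ⟨E₁, hE₁, h₁⟩ := ih fun f hf => avoid f (mem_insert_of_mem a hf)
      obtain ⟨E₂, hE₂, h₂⟩ := avoid a (mem_insert a s)
      rcases hc.total hE₁ hE₂ with h | h
      · exact ⟨E₁, hE₁, forall_mem_insert.2 ⟨fun ha => h₂ (h ha), h₁⟩⟩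
      · exact ⟨E₂, hE₂, forall_mem_insert.2 ⟨h₂, fun f hf hfE => h₁ f hf (h hfE)⟩⟩
  obtain ⟨E, hE, hEF⟩ := avoid_all
  obtain ⟨f, hf, hfE⟩ := h E hE
  exact hEF f hf hfE

/-- **Rudin's lemma**: a lower set meeting every member of a nonempty directed family of finite
sets contains a directed set meeting every member of the family. -/
theorem exists_isDirectedSet_subset_of_directedFam [PartialOrder α] {𝓕 : Set (Set α)}
    (hne : 𝓕.Nonempty) (hfin : ∀ F ∈ 𝓕, F.Finite) (hdir : DirectedFam 𝓕) {L : Set α}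
    (hL : IsLowerSet L) (hmeet : ∀ F ∈ 𝓕, (F ∩ L).Nonempty) :
    ∃ D ⊆ L, IsDirectedSet D ∧ ∀ F ∈ 𝓕, (F ∩ D).Nonempty := by
  obtain ⟨E, hEL, hmin⟩ := zorn_superset_nonempty
    {E : Set α | IsLowerSet E ∧ ∀ F ∈ 𝓕, (F ∩ E).Nonempty}
    (fun c hcS hc hcne => ⟨⋂₀ c, ⟨isLowerSet_sInter fun E hE => (hcS hE).1, fun F hF =>
      inter_sInter_nonempty_of_isChain hc hcne (hfin F hF) fun E hE => (hcS hE).2 F hF⟩,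
      fun E hE => sInter_subset_of_mem hE⟩) L ⟨hL, hmeet⟩
  obtain ⟨hElow, hEmeet⟩ := hmin.prop
  have above : ∀ a ∈ E, ∃ F ∈ 𝓕, ∀ f ∈ F, f ∈ E → a ≤ f := by
    intro a ha
    by_contra! hcon
    have hmem : E \ Ici a ∈ {E : Set α | IsLowerSet E ∧ ∀ F ∈ 𝓕, (F ∩ E).Nonempty} :=
      ⟨fun p q hqp hp => ⟨hElow hqp hp.1, fun haq => hp.2 (le_trans haq hqp)⟩, hcon⟩
    exact (hmin.le_of_le hmem sdiff_subset ha).2 le_rfl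
  refine ⟨E, hEL, ⟨?_, fun a ha b hb => ?_⟩, hEmeet⟩
  · obtain ⟨F, hF⟩ := hne
    exact (hEmeet F hF).mono inter_subset_right
  · obtain ⟨F₁, hF₁, h₁⟩ := above a ha
    obtain ⟨F₂, hF₂, h₂⟩ := above b hb
    obtain ⟨F₃, hF₃, h₃⟩ := hdir F₁ hF₁ F₂ hF₂
    obtain ⟨e, heF, heE⟩ := hEmeet F₃ hF₃
    obtain ⟨⟨f₁, hf₁, hle₁⟩, f₂, hf₂, hle₂⟩ := h₃ heF
    exact ⟨e, heE, (h₁ f₁ hf₁ (hElow hle₁ heE)).trans hle₁,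
      (h₂ f₂ hf₂ (hElow hle₂ heE)).trans hle₂⟩

theorem mem_upSet_of_wwb [PartialOrder α] {F : Set α} {x : α} (h : WWB F {x}) : x ∈ upSet F := by
  obtain ⟨d, rfl, hd⟩ := h {x} ⟨singleton_nonempty x, by simp⟩ x isLUB_singleton rfl
  exact hd

theorem upSet_singleton_subset_of_mem [PartialOrder α] {F : Set α} {x : α} (h : x ∈ upSet F) :
    upSet {x} ⊆ upSet F := by
  obtain ⟨f, hf, hfx⟩ := h
  rintro p ⟨_, rfl, hp⟩
  exact ⟨f, hf, hfx.trans hp⟩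

theorem inter_Iic_mem_finW [PartialOrder α] {F : Set α} {x : α} (h : F ∈ finW x) :
    F ∩ Iic x ∈ finW x := by
  obtain ⟨hfin, -, hw⟩ := h
  refine ⟨hfin.inter_of_left _, mem_upSet_of_wwb hw, ?_⟩
  rintro D hD _ hs rfl
  obtain ⟨d, hd, f, hf, hfd⟩ := hw D hD _ hs rfl
  exact ⟨d, hd, f, ⟨hf, hfd.trans (hs.1 hd)⟩, hfd⟩

/-- In a dcpo, a nonempty directed subfamily of `fin_w(x)` with intersection `↑x` is, after
restriction to `↓x`, cofinal in `fin_w(x)`. -/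
theorem exists_inter_Iic_subset_upSet [PartialOrder α] (hd : IsDcpo α) {x : α}
    {𝓕 : Set (Set α)} (hne : 𝓕.Nonempty) (hsub : 𝓕 ⊆ finW x) (hdir : DirectedFam 𝓕)
    (hinter : (⋂ F ∈ 𝓕, upSet F) = upSet {x}) {G : Set α} (hG : WWB G {x}) :
    ∃ F ∈ 𝓕, F ∩ Iic x ⊆ upSet G := by
  by_contra! hcon
  have hlow : IsLowerSet (Iic x \ upSet G) := fun p q hqp hp =>
    ⟨le_trans hqp hp.1, fun ⟨g, hg, hgq⟩ => hp.2 ⟨g, hg, hgq.trans hqp⟩⟩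
  obtain ⟨D, hDL, hD, hmeet⟩ := exists_isDirectedSet_subset_of_directedFam hne
    (fun F hF => (hsub hF).1) hdir hlow fun F hF => by
      obtain ⟨p, ⟨hpF, hpx⟩, hpG⟩ := not_subset.1 (hcon F hF)
      exact ⟨p, hpF, hpx, hpG⟩
  obtain ⟨s, hs⟩ := hd D hD
  have hxs : s ∈ upSet {x} := by
    rw [← hinter]
    refine mem_iInter₂.2 fun F hF => ?_
    obtain ⟨f, hfF, hfD⟩ := hmeet F hF
    exact ⟨f, hfF, hs.1 hfD⟩
  obtain ⟨_, rfl, hxs⟩ := hxs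
  obtain ⟨d, hdD, hdG⟩ := hG D hD s hs (le_antisymm (hs.2 fun d hd => (hDL hd).1) hxs)
  exact (hDL hdD).2 hdG

theorem directedFam_finW_of_forall_le [PartialOrder α] {x : α} (hx : ∀ p, x ≤ p) :
    DirectedFam (finW x) := by
  refine fun G₁ h₁ G₂ h₂ => ⟨{x}, ⟨finite_singleton x, singleton_nonempty x, ?_⟩,
    singleton_subset_iff.2 ⟨mem_upSet_of_wwb h₁.2.2, mem_upSet_of_wwb h₂.2.2⟩⟩
  intro D hD s _ _
  exact hD.1.imp fun d hd => ⟨hd, x, rfl, hx d⟩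

/-- A dcpo is quasiexact iff for every `x` there is a directed
subfamily `𝓕 ⊆ fin_w(x)` with `⋂ {↑F : F ∈ 𝓕} = ↑x`. -/
theorem quasiexact_iff_exists_directed_subfamily_of_finW [PartialOrder α]
    (hd : IsDcpo α) :
    Quasiexact α ↔
      ∀ x : α, ∃ 𝓕 : Set (Set α), 𝓕 ⊆ finW x ∧ DirectedFam 𝓕 ∧
        (⋂ F ∈ 𝓕, upSet F) = upSet {x} := by
  refine ⟨fun h x => ⟨finW x, Subset.rfl, h x⟩, fun h x => ?_⟩
  obtain ⟨𝓕, hsub, hdir, hinter⟩ := h x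
  refine ⟨?_, Subset.antisymm ((biInter_subset_biInter_left hsub).trans hinter.subset)
    (subset_iInter₂ fun F hF => upSet_singleton_subset_of_mem (mem_upSet_of_wwb hF.2.2))⟩
  rcases 𝓕.eq_empty_or_nonempty with rfl | hne
  · refine directedFam_finW_of_forall_le fun p => ?_
    obtain ⟨_, rfl, hp⟩ : p ∈ upSet {x} := hinter ▸ by simp
    exact hp
  · intro G₁ h₁ G₂ h₂
    obtain ⟨F₁, hF₁, hFG₁⟩ := exists_inter_Iic_subset_upSet hd hne hsub hdir hinter h₁.2.2
    obtain ⟨F₂, hF₂, hFG₂⟩ := exists_inter_Iic_subset_upSet hd hne hsub hdir hinter h₂.2.2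
    obtain ⟨F₃, hF₃, h₃⟩ := hdir F₁ hF₁ F₂ hF₂
    refine ⟨F₃ ∩ Iic x, inter_Iic_mem_finW (hsub hF₃), ?_⟩
    rintro p ⟨hp, hpx⟩
    obtain ⟨⟨f₁, hf₁, hle₁⟩, f₂, hf₂, hle₂⟩ := h₃ hp
    exact ⟨upSet_singleton_subset_of_mem (hFG₁ ⟨hf₁, hle₁.trans hpx⟩) ⟨f₁, rfl, hle₁⟩,
      upSet_singleton_subset_of_mem (hFG₂ ⟨hf₂, hle₂.trans hpx⟩) ⟨f₂, rfl, hle₂⟩⟩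
end
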